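/- Let l : M ⇄ D : r be a left model approximation of a category D with weak equivalences W. Then the localization of D with respect to W exists and has morphism sets Hom_{Ho(D)}(X, Y) = Hom_{Ho(M)}(rX, rY). Formally: the composite of r with the localization functor M → Ho(M) (localization of M at its weak equivalences) sends every morphism of W to an isomorphism, and the induced functor D[W⁻¹] → Ho(M) on localizations is fully faithful. -/

import Mathlib

open CategoryTheory CategoryTheory.Limits

universe w v u v₂ u₂ v₃ u₃

/-- A morphism `f` is a retract of a morphism `g` (in the arrow category). -/
def IsRetractOfArrow {C : Type*} [Category C] {X Y X' Y' : C}
    (f : X ⟶ Y) (g : X' ⟶ Y') : Prop :=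
  ∃ (a : X ⟶ X') (a' : X' ⟶ X) (b : Y ⟶ Y') (b' : Y' ⟶ Y),
    a ≫ a' = 𝟙 X ∧ b ≫ b' = 𝟙 Y ∧ a ≫ g = f ≫ b ∧ a' ≫ f = g ≫ b'

/-- A (Quillen) model structure on a category `M`: three distinguished classes of
morphisms (weak equivalences, fibrations and cofibrations) subject to the axioms
MC2–MC5 (two-out-of-three, retract stability, lifting and factorization).
Bicompleteness (MC1) is imposed separately via `HasLimits`/`HasColimits`. -/
structure ModelStructure (M : Type u) [Category.{v} M] where
  weq : MorphismProperty M
  fib : MorphismProperty M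
  cof : MorphismProperty M
  weq_of_isIso : ∀ {X Y : M} (f : X ⟶ Y), IsIso f → weq f
  weq_comp : ∀ {X Y Z : M} (f : X ⟶ Y) (g : Y ⟶ Z), weq f → weq g → weq (f ≫ g)
  weq_of_comp_left : ∀ {X Y Z : M} (f : X ⟶ Y) (g : Y ⟶ Z), weq f → weq (f ≫ g) → weq g
  weq_of_comp_right : ∀ {X Y Z : M} (f : X ⟶ Y) (g : Y ⟶ Z), weq g → weq (f ≫ g) → weq f
  weq_retract : ∀ {X Y X' Y' : M} {f : X ⟶ Y} {g : X' ⟶ Y'},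
    IsRetractOfArrow f g → weq g → weq f
  fib_retract : ∀ {X Y X' Y' : M} {f : X ⟶ Y} {g : X' ⟶ Y'},
    IsRetractOfArrow f g → fib g → fib f
  cof_retract : ∀ {X Y X' Y' : M} {f : X ⟶ Y} {g : X' ⟶ Y'},
    IsRetractOfArrow f g → cof g → cof f
  lifting_cof_acyclicFib : ∀ {A B X Y : M} (i : A ⟶ B) (p : X ⟶ Y),
    cof i → fib p → weq p → HasLiftingProperty i p
  lifting_acyclicCof_fib : ∀ {A B X Y : M} (i : A ⟶ B) (p : X ⟶ Y),
    cof i → weq i → fib p → HasLiftingProperty i p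
  factorization_cof_acyclicFib : ∀ {X Y : M} (f : X ⟶ Y),
    ∃ (Z : M) (i : X ⟶ Z) (p : Z ⟶ Y), cof i ∧ fib p ∧ weq p ∧ i ≫ p = f
  factorization_acyclicCof_fib : ∀ {X Y : M} (f : X ⟶ Y),
    ∃ (Z : M) (i : X ⟶ Z) (p : Z ⟶ Y), cof i ∧ weq i ∧ fib p ∧ i ≫ p = f

variable {M : Type u} [Category.{v} M]

/-- An object is cofibrant if the map from the initial object to it is a cofibration. -/
def ModelStructure.Cofibrant [HasInitial M] (ms : ModelStructure M) (A : M) : Prop :=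
  ms.cof (initial.to A)

/-- An object is fibrant if the map to the terminal object is a fibration. -/
def ModelStructure.Fibrant [HasTerminal M] (ms : ModelStructure M) (X : M) : Prop :=
  ms.fib (terminal.from X)

/-- A category with weak equivalences: a distinguished class of morphisms containing
all isomorphisms and satisfying the two-out-of-three property. -/
structure WeakEquivalences (C : Type u₂) [Category.{v₂} C] where
  W : MorphismProperty C
  W_of_isIso : ∀ {X Y : C} (f : X ⟶ Y), IsIso f → W f
  W_comp : ∀ {X Y Z : C} (f : X ⟶ Y) (g : Y ⟶ Z), W f → W g → W (f ≫ g)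
  W_of_comp_left : ∀ {X Y Z : C} (f : X ⟶ Y) (g : Y ⟶ Z), W f → W (f ≫ g) → W g
  W_of_comp_right : ∀ {X Y Z : C} (f : X ⟶ Y) (g : Y ⟶ Z), W g → W (f ≫ g) → W f

/-- A functor `H : M ⥤ C` from a model category to a category with weak equivalences is
homotopy meaningful on cofibrant objects if it sends weak equivalences between cofibrant
objects of `M` to weak equivalences of `C`. -/
def HomotopyMeaningfulOnCofibrant [HasInitial M] (ms : ModelStructure M)
    {C : Type u₂} [Category.{v₂} C] (wC : WeakEquivalences C) (H : M ⥤ C) : Prop :=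
  ∀ {X Y : M} (f : X ⟶ Y),
    ms.Cofibrant X → ms.Cofibrant Y → ms.weq f → wC.W (H.map f)

/-- A left model approximation of a category `D` with weak equivalences `wD`: a model
category `(M, ms)` together with an adjoint pair `l : M ⇄ D : r` such that `r` is
homotopy meaningful, `l` is homotopy meaningful on cofibrant objects, and for every
cofibrant `X` in `M` the adjoint of a weak equivalence `X ⟶ r A` is a weak
equivalence `l X ⟶ A`. -/
structure LeftModelApproximation {M : Type u} [Category.{v} M] [HasInitial M]
    (ms : ModelStructure M) {D : Type u₂} [Category.{v₂} D]
    (wD : WeakEquivalences D) where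
  l : M ⥤ D
  r : D ⥤ M
  adj : l ⊣ r
  r_weq : ∀ {X Y : D} (f : X ⟶ Y), wD.W f → ms.weq (r.map f)
  l_meaningful : ∀ {X Y : M} (f : X ⟶ Y),
    ms.Cofibrant X → ms.Cofibrant Y → ms.weq f → wD.W (l.map f)
  adjoint_weq : ∀ {X : M} {A : D} (φ : X ⟶ r.obj A),
    ms.Cofibrant X → ms.weq φ → wD.W ((adj.homEquiv X A).symm φ)

open HomotopicalAlgebra

/-- The Mathlib model category associated to a `ModelStructure`. -/
@[reducible]
def ModelStructure.toModelCategory {M : Type u} [Category.{v} M] [HasLimits M] [HasColimits M]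
    (ms : ModelStructure M) : ModelCategory M :=
  letI i1 : CategoryWithFibrations M := ⟨ms.fib⟩
  letI i2 : CategoryWithCofibrations M := ⟨ms.cof⟩
  letI i3 : CategoryWithWeakEquivalences M := ⟨ms.weq⟩
  { categoryWithFibrations := i1
    categoryWithCofibrations := i2
    categoryWithWeakEquivalences := i3
    cm1a := inferInstance
    cm1b := inferInstance
    cm2 :=
      { comp_mem := fun f g hf hg => ms.weq_comp f g hf hg
        of_postcomp := fun f g hg hfg => ms.weq_of_comp_right f g hg hfg
        of_precomp := fun f g hf hfg => ms.weq_of_comp_left f g hf hfg }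
    cm3a := ⟨fun {X Y Z W f g} h hg => ms.weq_retract
      ⟨h.i.left, h.r.left, h.i.right, h.r.right, h.retract_left, h.retract_right,
        h.i_w, h.r_w⟩ hg⟩
    cm3b := ⟨fun {X Y Z W f g} h hg => ms.fib_retract
      ⟨h.i.left, h.r.left, h.i.right, h.r.right, h.retract_left, h.retract_right,
        h.i_w, h.r_w⟩ hg⟩
    cm3c := ⟨fun {X Y Z W f g} h hg => ms.cof_retract
      ⟨h.i.left, h.r.left, h.i.right, h.r.right, h.retract_left, h.retract_right,
        h.i_w, h.r_w⟩ hg⟩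
    cm4a := fun i p h1 h2 h3 => ms.lifting_acyclicCof_fib i p h1.mem h2.mem h3.mem
    cm4b := fun i p h1 h2 h3 => ms.lifting_cof_acyclicFib i p h1.mem h2.mem h3.mem
    cm5a := ⟨fun f => by
      obtain ⟨Z, i, p, h1, h2, h3, h4⟩ := ms.factorization_acyclicCof_fib f
      exact ⟨{ Z := Z, i := i, p := p, fac := h4, hi := ⟨h1, h2⟩, hp := h3 }⟩⟩
    cm5b := ⟨fun f => by
      obtain ⟨Z, i, p, h1, h2, h3, h4⟩ := ms.factorization_cof_acyclicFib f
      exact ⟨{ Z := Z, i := i, p := p, fac := h4, hi := h1, hp := ⟨h2, h3⟩ }⟩⟩ }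

/-- Formal part of the argument: a functor `F'` with a "unit" and an invertible "counit"
satisfying one triangle identity is fully faithful. -/
lemma full_faithful_of_triangle {A : Type*} [Category* A] {B : Type*} [Category* B]
    (F : A ⥤ B) (G : B ⥤ A) (η : 𝟭 B ⟶ G ⋙ F) (ε : F ⋙ G ⟶ 𝟭 A) [IsIso ε]
    (h : ∀ X, η.app (F.obj X) ≫ F.map (ε.app X) = 𝟙 _) : F.Full ∧ F.Faithful := by
  constructor
  · refine ⟨fun {X Y} ψ => ⟨inv (ε.app X) ≫ G.map ψ ≫ ε.app Y, ?_⟩⟩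
    have h1 : η.app (F.obj X) = inv (F.map (ε.app X)) := by
      rw [← cancel_mono (F.map (ε.app X)), h, IsIso.inv_hom_id]
    have h2 := η.naturality ψ
    dsimp at h2
    rw [F.map_comp, F.map_comp, F.map_inv]
    have h1' : inv (F.map (ε.app X)) = η.app (F.obj X) := h1.symm
    rw [h1', ← Category.assoc, ← h2, Category.assoc, h]
    exact Category.comp_id ψ
  · refine ⟨fun {X Y f g} hfg => ?_⟩
    have h1 := ε.naturality f
    have h2 := ε.naturality g
    dsimp at h1 h2
    rw [hfg] at h1
    rw [← cancel_epi (ε.app X), ← h1, h2]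

lemma approximation_aux {M : Type*} [Category* M] {D : Type*} [Category* D]
    {Mc : Type*} [Category* Mc] {HM : Type*} [Category* HM] {HD : Type*} [Category* HD]
    (ι : Mc ⥤ M) (Wc : MorphismProperty Mc) (WM : MorphismProperty M) (WD : MorphismProperty D)
    (L : M ⥤ HM) (Q : D ⥤ HD) (hL : WM.IsInvertedBy L)
    [(ι ⋙ L).IsLocalization Wc] [Q.IsLocalization WD]
    (l : M ⥤ D) (r : D ⥤ M) (adj : l ⊣ r) (F : HD ⥤ HM) (β : r ⋙ L ≅ Q ⋙ F)
    (hl : Wc.IsInvertedBy (ι ⋙ l ⋙ Q))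
    (R : M → Mc) (p : ∀ X, ι.obj (R X) ⟶ X) (hp : ∀ X, WM (p X))
    (hR : ∀ {X Y : M} (f : X ⟶ Y), ∃ g : R X ⟶ R Y, ι.map g ≫ p Y = p X ≫ f)
    (hadj : ∀ A : D, WD (l.map (p (r.obj A)) ≫ adj.counit.app A)) :
    F.Full ∧ F.Faithful := by
  let G : HM ⥤ HD := Localization.lift (ι ⋙ l ⋙ Q) hl (ι ⋙ L)
  let e : (ι ⋙ L) ⋙ G ≅ ι ⋙ l ⋙ Q := Localization.fac (ι ⋙ l ⋙ Q) hl (ι ⋙ L)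
  have isoL (X : M) : IsIso (L.map (p X)) := hL _ (hp X)
  have e_nat {X Y : Mc} (g : X ⟶ Y) : G.map (L.map (ι.map g)) ≫ e.hom.app Y =
      e.hom.app X ≫ Q.map (l.map (ι.map g)) := e.hom.naturality g
  have β_nat {X Y : D} (g : X ⟶ Y) : L.map (r.map g) ≫ β.hom.app Y =
      β.hom.app X ≫ F.map (Q.map g) := β.hom.naturality g
  let α : L ⋙ G ⟶ l ⋙ Q :=
    { app := fun X => inv (G.map (L.map (p X))) ≫ e.hom.app (R X) ≫ Q.map (l.map (p X))
      naturality := fun X Y f => by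
        obtain ⟨g, hg⟩ := hR f
        have h1 : G.map (L.map (ι.map g)) ≫ G.map (L.map (p Y)) =
            G.map (L.map (p X)) ≫ G.map (L.map f) := by
          simp only [← Functor.map_comp, hg]
        have h2 : Q.map (l.map (ι.map g)) ≫ Q.map (l.map (p Y)) =
            Q.map (l.map (p X)) ≫ Q.map (l.map f) := by
          simp only [← Functor.map_comp, hg]
        dsimp only [Functor.comp_map]
        rw [← cancel_epi (G.map (L.map (p X)))]
        have h3 : G.map (L.map (p X)) ≫ G.map (L.map f) ≫ inv (G.map (L.map (p Y))) =
            G.map (L.map (ι.map g)) := by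
          rw [← Category.assoc, ← h1, Category.assoc, IsIso.hom_inv_id, Category.comp_id]
        have h4 := e_nat g
        calc _ = (G.map (L.map (p X)) ≫ G.map (L.map f) ≫ inv (G.map (L.map (p Y)))) ≫
              e.hom.app (R Y) ≫ Q.map (l.map (p Y)) := by simp only [Category.assoc]
          _ = e.hom.app (R X) ≫ Q.map (l.map (p X)) ≫ Q.map (l.map f) := by
              rw [h3, ← Category.assoc, h4, Category.assoc, h2]
          _ = _ := by simp only [Category.assoc, IsIso.hom_inv_id_assoc] }
  have hα (X : M) : G.map (L.map (p X)) ≫ α.app X = e.hom.app (R X) ≫ Q.map (l.map (p X)) :=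
    IsIso.hom_inv_id_assoc _ _
  -- the counit
  let ε₀ : Q ⋙ (F ⋙ G) ⟶ Q ⋙ 𝟭 HD :=
    { app := fun A => G.map (β.inv.app A) ≫ α.app (r.obj A) ≫ Q.map (adj.counit.app A)
      naturality := fun A B f => by
        have h1 : G.map (F.map (Q.map f)) ≫ G.map (β.inv.app B) =
            G.map (β.inv.app A) ≫ G.map (L.map (r.map f)) := by
          rw [← G.map_comp, ← G.map_comp]; exact congrArg G.map (β.inv.naturality f)
        have h2 : G.map (L.map (r.map f)) ≫ α.app (r.obj B) =
            α.app (r.obj A) ≫ Q.map (l.map (r.map f)) := α.naturality (r.map f)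
        have h3 : Q.map (l.map (r.map f)) ≫ Q.map (adj.counit.app B) =
            Q.map (adj.counit.app A) ≫ Q.map f := by
          rw [← Q.map_comp, ← Q.map_comp]; exact congrArg Q.map (adj.counit.naturality f)
        calc _ = (G.map (F.map (Q.map f)) ≫ G.map (β.inv.app B)) ≫ α.app (r.obj B) ≫
              Q.map (adj.counit.app B) := by
                simp only [Functor.comp_map, Category.assoc]
          _ = G.map (β.inv.app A) ≫ α.app (r.obj A) ≫ Q.map (adj.counit.app A) ≫ Q.map f := by
            rw [h1, Category.assoc, reassoc_of% h2, h3]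
          _ = _ := by simp only [Functor.comp_map, Functor.id_map, Category.assoc] }
  let ε : F ⋙ G ⟶ 𝟭 HD := (Localization.whiskeringLeftFunctor' Q WD HD).preimage ε₀
  have hε' (A : D) : ε.app (Q.obj A) = ε₀.app A :=
    congr_app ((Localization.whiskeringLeftFunctor' Q WD HD).map_preimage ε₀) A
  have hε (A : D) : G.map (L.map (p (r.obj A))) ≫ G.map (β.hom.app A) ≫ ε.app (Q.obj A) =
      e.hom.app (R (r.obj A)) ≫ Q.map (l.map (p (r.obj A)) ≫ adj.counit.app A) := by
    have h1 : G.map (β.hom.app A) ≫ G.map (β.inv.app A) = 𝟙 _ := by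
      rw [← G.map_comp, Iso.hom_inv_id_app, G.map_id]
    rw [hε']
    dsimp only [ε₀]
    rw [reassoc_of% h1, reassoc_of% (hα (r.obj A)), Q.map_comp]
  have : Q.EssSurj := Localization.essSurj Q WD
  have : IsIso ε := by
    have h0 (A : D) : IsIso (ε.app (Q.obj A)) := by
      have : IsIso (Q.map (l.map (p (r.obj A)) ≫ adj.counit.app A)) :=
        Localization.inverts Q WD _ (hadj A)
      have h1 : IsIso (G.map (L.map (p (r.obj A))) ≫ G.map (β.hom.app A) ≫ ε.app (Q.obj A)) := by
        rw [hε]; infer_instance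
      have h2 := IsIso.of_isIso_comp_left (G.map (L.map (p (r.obj A))))
        (G.map (β.hom.app A) ≫ ε.app (Q.obj A))
      exact IsIso.of_isIso_comp_left (G.map (β.hom.app A)) (ε.app (Q.obj A))
    rw [NatTrans.isIso_iff_isIso_app]
    intro Y
    rw [NatTrans.isIso_app_iff_of_iso ε (Q.objObjPreimageIso Y).symm]
    exact h0 _
  -- the unit
  let η₀ : (ι ⋙ L) ⋙ 𝟭 HM ⟶ (ι ⋙ L) ⋙ (G ⋙ F) :=
    { app := fun X => L.map (adj.unit.app (ι.obj X)) ≫ β.hom.app (l.obj (ι.obj X)) ≫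
        F.map (e.inv.app X)
      naturality := fun X Y g => by
        have h1 : F.map (Q.map (l.map (ι.map g))) ≫ F.map (e.inv.app Y) =
            F.map (e.inv.app X) ≫ F.map (G.map (L.map (ι.map g))) := by
          rw [← F.map_comp, ← F.map_comp]; exact congrArg F.map (e.inv.naturality g)
        have h2 := β_nat (l.map (ι.map g))
        have h3 : L.map (ι.map g) ≫ L.map (adj.unit.app (ι.obj Y)) =
            L.map (adj.unit.app (ι.obj X)) ≫ L.map (r.map (l.map (ι.map g))) := by
          rw [← L.map_comp, ← L.map_comp]; exact congrArg L.map (adj.unit.naturality (ι.map g))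
        dsimp only [Functor.comp_map, Functor.id_map]
        rw [reassoc_of% h3, reassoc_of% h2, h1]
        simp only [Category.assoc] }
  let η : 𝟭 HM ⟶ G ⋙ F := (Localization.whiskeringLeftFunctor' (ι ⋙ L) Wc HM).preimage η₀
  have hη (X : Mc) : η.app (L.obj (ι.obj X)) = L.map (adj.unit.app (ι.obj X)) ≫
      β.hom.app (l.obj (ι.obj X)) ≫ F.map (e.inv.app X) :=
    congr_app ((Localization.whiskeringLeftFunctor' (ι ⋙ L) Wc HM).map_preimage η₀) X
  refine full_faithful_of_triangle F G η ε ?_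
  have tri (A : D) : η.app (F.obj (Q.obj A)) ≫ F.map (ε.app (Q.obj A)) = 𝟙 _ := by
    rw [← cancel_epi (L.map (p (r.obj A)) ≫ β.hom.app A)]
    have n := η.naturality (L.map (p (r.obj A)) ≫ β.hom.app A)
    dsimp only [Functor.comp_map, Functor.id_map] at n
    have h1 := congrArg F.map (hε A)
    rw [← Category.assoc, ← G.map_comp, F.map_comp, F.map_comp] at h1
    have h2 := β_nat (l.map (p (r.obj A)) ≫ adj.counit.app A)
    have h3 : adj.unit.app (ι.obj (R (r.obj A))) ≫
        r.map (l.map (p (r.obj A)) ≫ adj.counit.app A) = p (r.obj A) := by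
      have h5 : p (r.obj A) ≫ adj.unit.app (r.obj A) = adj.unit.app (ι.obj (R (r.obj A))) ≫
          r.map (l.map (p (r.obj A))) := adj.unit.naturality (p (r.obj A))
      have h6 := adj.right_triangle_components A
      calc _ = (adj.unit.app (ι.obj (R (r.obj A))) ≫ r.map (l.map (p (r.obj A)))) ≫
            r.map (adj.counit.app A) := by rw [r.map_comp, Category.assoc]
        _ = _ := by rw [← h5, Category.assoc, h6]; exact Category.comp_id _
    have h4 : F.map (e.inv.app (R (r.obj A))) ≫ F.map (e.hom.app (R (r.obj A))) = 𝟙 _ := by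
      rw [← F.map_comp, Iso.inv_hom_id_app, F.map_id]
    calc _ = ((L.map (p (r.obj A)) ≫ β.hom.app A) ≫ η.app (F.obj (Q.obj A))) ≫
          F.map (ε.app (Q.obj A)) := (Category.assoc _ _ _).symm
      _ = (η.app (L.obj (ι.obj (R (r.obj A)))) ≫
          F.map (G.map (L.map (p (r.obj A)) ≫ β.hom.app A))) ≫ F.map (ε.app (Q.obj A)) :=
            congrArg (fun t => t ≫ F.map (ε.app (Q.obj A))) n
      _ = L.map (adj.unit.app (ι.obj (R (r.obj A)))) ≫
          β.hom.app (l.obj (ι.obj (R (r.obj A)))) ≫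
          F.map (Q.map (l.map (p (r.obj A)) ≫ adj.counit.app A)) := by
            rw [Category.assoc, h1, hη]
            simp only [Category.assoc]
            rw [reassoc_of% h4]
      _ = L.map (p (r.obj A)) ≫ β.hom.app A := by
            rw [← h2, ← Category.assoc, ← L.map_comp, h3]; rfl
      _ = _ := (Category.comp_id _).symm
  intro Y
  let i := Q.objObjPreimageIso Y
  have n1 := η.naturality (F.map i.hom)
  have n2 := congrArg F.map (ε.naturality i.hom)
  dsimp only [Functor.comp_map, Functor.id_map] at n1 n2
  rw [F.map_comp, F.map_comp] at n2
  rw [← cancel_epi (F.map i.hom), reassoc_of% n1, n2, reassoc_of% (tri _)]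
  exact (Category.comp_id _).symm

/-- Let `l : M ⇄ D : r` be a left model approximation of `D` (with
weak equivalences `W`). Then the localization of `D` at `W` exists, with
`Hom_{Ho(D)}(X, Y) = Hom_{Ho(M)}(r X, r Y)`: the composite of `r` with the localization
functor `M ⥤ Ho(M)` inverts `W`, and the induced functor `D[W⁻¹] ⥤ Ho(M)` is fully
faithful. -/
theorem leftModelApproximation_localization
    {M : Type u} [Category.{v} M] [HasLimits M] [HasColimits M]
    (ms : ModelStructure M) {D : Type u₂} [Category.{v₂} D]
    (wD : WeakEquivalences D) (appr : LeftModelApproximation ms wD) :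
    ∃ h : wD.W.IsInvertedBy (appr.r ⋙ ms.weq.Q),
      (Localization.lift (appr.r ⋙ ms.weq.Q) h wD.W.Q).Full ∧
      (Localization.lift (appr.r ⋙ ms.weq.Q) h wD.W.Q).Faithful := by
  let _ := ms.toModelCategory
  have h : wD.W.IsInvertedBy (appr.r ⋙ ms.weq.Q) := fun X Y f hf =>
    Localization.inverts ms.weq.Q ms.weq _ (appr.r_weq f hf)
  refine ⟨h, ?_⟩
  have : (CofibrantObject.ι ⋙ ms.weq.Q).IsLocalization (weakEquivalences (CofibrantObject M)) :=
    inferInstanceAs (((CofibrantObject.localizerMorphism M).functor ⋙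
      (weakEquivalences M).Q).IsLocalization _)
  refine approximation_aux CofibrantObject.ι (weakEquivalences (CofibrantObject M)) ms.weq wD.W
    ms.weq.Q wD.W.Q (Localization.inverts _ _) appr.l appr.r appr.adj _
    (Localization.fac (appr.r ⋙ ms.weq.Q) h wD.W.Q).symm ?_
    (fun X => CofibrantObject.mk (CofibrantObject.HoCat.resolutionObj X))
    (fun X => CofibrantObject.HoCat.pResolutionObj X)
    (fun X => (mem_weakEquivalences (CofibrantObject.HoCat.pResolutionObj X) :)) ?_ ?_
  · intro X Y f hf
    exact Localization.inverts wD.W.Q wD.W _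
      (appr.l_meaningful f.hom X.property.mem Y.property.mem hf)
  · intro X Y f
    exact ⟨CofibrantObject.homMk (CofibrantObject.HoCat.resolutionMap f),
      CofibrantObject.HoCat.resolutionMap_fac f⟩
  · intro A
    have := appr.adjoint_weq (CofibrantObject.HoCat.pResolutionObj (appr.r.obj A))
      (inferInstance : IsCofibrant (CofibrantObject.HoCat.resolutionObj (appr.r.obj A))).mem
      (mem_weakEquivalences (CofibrantObject.HoCat.pResolutionObj (appr.r.obj A)))
    rwa [Adjunction.homEquiv_counit] at this
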